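/- arXiv:1910.07435 — 6 statements merged into one kernel-verified Lean document; each statement's English description precedes it below -/
import Mathlib

section
/- Let E be a finite-dimensional real normed vector space, let F be a Minkowski gauge on E, and let v ∈ E satisfy F(-v) < 1. Then for every w ∈ E with w ≠ 0 there exists a unique real number s > 0 such that F(w - s•v) = s. (This is the well-definedness of the Zermelo navigation metric: its value at w is this unique s.) -/
/-- A convex positively homogeneous function is subadditive. -/
theorem ConvexOn.map_add_le_of_posHomogeneous {E : Type*} [AddCommGroup E] [Module ℝ E]
    {F : E → ℝ} (hFconv : ConvexOn ℝ Set.univ F)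
    (hFhom : ∀ c : ℝ, 0 ≤ c → ∀ y : E, F (c • y) = c * F y) (x y : E) :
    F (x + y) ≤ F x + F y := by
  have h := hFconv.2 (Set.mem_univ x) (Set.mem_univ y)
    (by norm_num : (0 : ℝ) ≤ 1 / 2) (by norm_num : (0 : ℝ) ≤ 1 / 2) (by norm_num)
  rw [← smul_add, hFhom _ (by norm_num), smul_eq_mul, smul_eq_mul] at h
  linarith

/-- For a Minkowski gauge `F` on a finite-dimensional real normed
vector space `E` and `v` with `F (-v) < 1`, for every `w ≠ 0` there is a unique
`s > 0` with `F (w - s • v) = s`. -/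
theorem zermelo_navigation_well_defined
    {E : Type*} [NormedAddCommGroup E] [NormedSpace ℝ E] [FiniteDimensional ℝ E]
    (F : E → ℝ)
    (hFcont : Continuous F)
    (hFconv : ConvexOn ℝ Set.univ F)
    (hFhom : ∀ c : ℝ, 0 ≤ c → ∀ y : E, F (c • y) = c * F y)
    (hFpos : ∀ y : E, y ≠ 0 → 0 < F y)
    (v : E) (hv : F (-v) < 1)
    (w : E) (hw : w ≠ 0) :
    ∃! s : ℝ, 0 < s ∧ F (w - s • v) = s := by
  have growth : ∀ s t : ℝ, s ≤ t → F (w - t • v) ≤ F (w - s • v) + (t - s) * F (-v) := by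
    intro s t hst
    rw [← hFhom _ (sub_nonneg.2 hst)]
    convert hFconv.map_add_le_of_posHomogeneous hFhom (w - s • v) ((t - s) • -v) using 2
    module
  have anti : StrictAnti fun s : ℝ => F (w - s • v) - s := by
    intro s t hst
    have := growth s t hst.le
    have := mul_lt_mul_of_pos_left hv (sub_pos.2 hst)
    dsimp only
    linarith
  have hFw := hFpos w hw
  have hpos : 0 < 1 - F (-v) := sub_pos.2 hv
  set T := F w / (1 - F (-v))
  have hTnonneg : 0 ≤ T := by positivity
  have hTmul : T * (1 - F (-v)) = F w := div_mul_cancel₀ _ hpos.ne'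
  have hend : F (w - T • v) - T ≤ 0 := by
    have := growth 0 T hTnonneg
    simp only [zero_smul, sub_zero] at this
    linarith
  have hstart : 0 ≤ F (w - (0 : ℝ) • v) - 0 := by simpa using hFw.le
  have hcont : Continuous fun s : ℝ => F (w - s • v) - s := by fun_prop
  obtain ⟨s, hs, hs0⟩ := intermediate_value_Icc' hTnonneg hcont.continuousOn ⟨hend, hstart⟩
  refine ⟨s, ⟨hs.1.lt_of_ne ?_, sub_eq_zero.1 hs0⟩, fun t ht => ?_⟩
  · rintro rfl
    simp only [zero_smul, sub_zero] at hs0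
    exact hFw.ne' hs0
  · exact anti.injective ((sub_eq_zero.2 ht.2).trans hs0.symm)
end

section
/- Let E be a finite-dimensional real normed vector space, let F be a Minkowski gauge on E, and let v ∈ E satisfy F(-v) < 1. Then the map φ : E → E defined by φ(y) = y + F(y)•v is a bijection of E onto E, and it is positively homogeneous: φ(λ•y) = λ•φ(y) for all λ ≥ 0 and y ∈ E. -/
/-- A convex, positively homogeneous function is subadditive. -/
theorem ConvexOn.add_le_of_posHom {E : Type*} [AddCommGroup E] [Module ℝ E] {F : E → ℝ}
    (hconv : ConvexOn ℝ Set.univ F)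
    (hhom : ∀ c : ℝ, 0 ≤ c → ∀ y : E, F (c • y) = c * F y) (x y : E) :
    F (x + y) ≤ F x + F y := by
  have h := hconv.2 (Set.mem_univ x) (Set.mem_univ y) (by norm_num : (0 : ℝ) ≤ 1 / 2)
    (by norm_num : (0 : ℝ) ≤ 1 / 2) (by norm_num)
  rw [← smul_add, hhom _ (by norm_num)] at h
  simp only [smul_eq_mul] at h
  linarith

/-- The map `φ y = y + F y • v` is a bijection of `E` onto `E`,
and it is positively homogeneous. -/
theorem zermelo_navigation_map_bijective
    {E : Type*} [NormedAddCommGroup E] [NormedSpace ℝ E] [FiniteDimensional ℝ E]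
    (F : E → ℝ)
    (hFcont : Continuous F)
    (hFconv : ConvexOn ℝ Set.univ F)
    (hFhom : ∀ c : ℝ, 0 ≤ c → ∀ y : E, F (c • y) = c * F y)
    (hFpos : ∀ y : E, y ≠ 0 → 0 < F y)
    (v : E) (hv : F (-v) < 1) :
    Function.Bijective (fun y : E => y + F y • v) ∧
      ∀ c : ℝ, 0 ≤ c → ∀ y : E,
        (c • y) + F (c • y) • v = c • (y + F y • v) := by
  have hadd := hFconv.add_le_of_posHom hFhom
  refine ⟨⟨?_, ?_⟩, fun c hc y => by rw [hFhom c hc, smul_add, mul_smul]⟩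
  · have le_of_eq : ∀ a b : E, a + F a • v = b + F b • v → F a ≤ F b := by
      intro a b h
      by_contra! hlt
      have ha : a = b + (F a - F b) • (-v) :=
        (eq_sub_of_add_eq h).trans (by module)
      have h1 := hadd b ((F a - F b) • (-v))
      rw [← ha, hFhom _ (sub_pos.2 hlt).le] at h1
      nlinarith [mul_pos (sub_pos.2 hlt) (sub_pos.2 hv)]
    intro a b h
    have hF : F a = F b := le_antisymm (le_of_eq a b h) (le_of_eq b a h.symm)
    simpa [hF] using h
  · intro z
    have hz : 0 ≤ F z := by
      rcases eq_or_ne z 0 with rfl | hne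
      · simpa using (hFhom 0 le_rfl 0).ge
      · exact (hFpos z hne).le
    have hd : 0 < 1 - F (-v) := sub_pos.2 hv
    set T := F z / (1 - F (-v)) with hT
    have hT0 : 0 ≤ T := div_nonneg hz hd.le
    have hTz : T * (1 - F (-v)) = F z := div_mul_cancel₀ _ hd.ne'
    have hcont : Continuous fun t : ℝ => F (z + t • (-v)) - t := by fun_prop
    have hend : F (z + T • (-v)) - T ≤ 0 := by
      have h1 := hadd z (T • (-v))
      rw [hFhom T hT0] at h1
      linarith
    obtain ⟨t, -, ht⟩ := intermediate_value_Icc' hT0 hcont.continuousOn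
      ⟨hend, by simpa using hz⟩
    refine ⟨z + t • (-v), ?_⟩
    simp only [sub_eq_zero.1 ht]
    module
end

section
/- Let E be a finite-dimensional real normed vector space, let F be a Minkowski gauge on E, let v ∈ E satisfy F(-v) < 1, and let F̃ : E → ℝ be continuous, positively homogeneous, positive on nonzero vectors, and satisfy the navigation identity F̃(y + F(y)•v) = F(y) for all y ∈ E. Then the closed unit ball of F̃ is the translate by v of the closed unit ball of F, i.e. {w ∈ E : F̃(w) ≤ 1} = {y + v : y ∈ E, F(y) ≤ 1}; consequently F̃ is convex. -/
/-- A convex positively homogeneous function is subadditive. -/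
theorem ConvexOn.add_le_of_posHomogeneous {E : Type*} [AddCommGroup E] [Module ℝ E] {F : E → ℝ}
    (hF : ConvexOn ℝ Set.univ F) (hhom : ∀ c : ℝ, 0 ≤ c → ∀ y : E, F (c • y) = c * F y)
    (x y : E) : F (x + y) ≤ F x + F y := by
  have h := hF.2 (Set.mem_univ x) (Set.mem_univ y) (by norm_num : (0 : ℝ) ≤ 1 / 2)
    (by norm_num : (0 : ℝ) ≤ 1 / 2) (by norm_num)
  rw [← smul_add, hhom _ (by norm_num)] at h
  simp only [smul_eq_mul] at h
  linarith

/-- If `F` is continuous, nonnegative and sublinear with `F (-v) < 1`, then every line in the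
direction `-v` meets the graph of the navigation problem: `F (w - t • v) = t` has a solution. -/
theorem exists_navigation_time {E : Type*} [AddCommGroup E] [Module ℝ E] [TopologicalSpace E]
    [IsTopologicalAddGroup E] [ContinuousSMul ℝ E] {F : E → ℝ} (hcont : Continuous F)
    (hhom : ∀ c : ℝ, 0 ≤ c → ∀ y : E, F (c • y) = c * F y)
    (hadd : ∀ x y : E, F (x + y) ≤ F x + F y) (hnonneg : ∀ y : E, 0 ≤ F y)
    {v : E} (hv : F (-v) < 1) (w : E) : ∃ t : ℝ, F (w - t • v) = t := by
  have hd : 0 < 1 - F (-v) := by linarith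
  set T : ℝ := F w / (1 - F (-v)) with hT
  have hT0 : 0 ≤ T := div_nonneg (hnonneg w) hd.le
  have hTmul : T * (1 - F (-v)) = F w := div_mul_cancel₀ _ hd.ne'
  have hupper : F (w - T • v) - T ≤ 0 := by
    have h := hadd w (T • -v)
    rw [hhom T hT0, smul_neg, ← sub_eq_add_neg] at h
    linarith
  have hlower : 0 ≤ F (w - (0 : ℝ) • v) - 0 := by simpa using hnonneg w
  have hg : Continuous fun t : ℝ => F (w - t • v) - t := by fun_prop
  obtain ⟨t, -, ht⟩ := intermediate_value_Icc' hT0 hg.continuousOn ⟨hupper, hlower⟩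
  exact ⟨t, sub_eq_zero.mp ht⟩

/-- The closed unit ball of the navigation metric `F̃` is the
translate by `v` of the closed unit ball of `F`; consequently `F̃` is convex. -/
theorem zermelo_navigation_unit_ball_translate
    {E : Type*} [NormedAddCommGroup E] [NormedSpace ℝ E] [FiniteDimensional ℝ E]
    (F : E → ℝ)
    (hFcont : Continuous F)
    (hFconv : ConvexOn ℝ Set.univ F)
    (hFhom : ∀ c : ℝ, 0 ≤ c → ∀ y : E, F (c • y) = c * F y)
    (hFpos : ∀ y : E, y ≠ 0 → 0 < F y)
    (v : E) (hv : F (-v) < 1)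
    (Ft : E → ℝ)
    (hFtcont : Continuous Ft)
    (hFthom : ∀ c : ℝ, 0 ≤ c → ∀ w : E, Ft (c • w) = c * Ft w)
    (hFtpos : ∀ w : E, w ≠ 0 → 0 < Ft w)
    (hnav : ∀ y : E, Ft (y + F y • v) = F y) :
    {w : E | Ft w ≤ 1} = (fun y : E => y + v) '' {y : E | F y ≤ 1} ∧
      ConvexOn ℝ Set.univ Ft := by
  have hadd := hFconv.add_le_of_posHomogeneous hFhom
  have hF0 : F 0 = 0 := by simpa using hFhom 0 le_rfl 0
  have hnonneg : ∀ y, 0 ≤ F y := fun y => by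
    rcases eq_or_ne y 0 with rfl | hy
    · exact hF0.ge
    · exact (hFpos y hy).le
  have hsol : ∀ w, F (w - Ft w • v) = Ft w := fun w => by
    obtain ⟨t, ht⟩ := exists_navigation_time hFcont hFhom hadd hnonneg hv w
    have h := hnav (w - t • v)
    rw [ht, sub_add_cancel] at h
    rw [h, ht]
  have hshift : ∀ (w : E) (s t : ℝ), s ≤ t →
      F (w - t • v) ≤ F (w - s • v) + (t - s) * F (-v) := fun w s t hst => by
    have h := hadd (w - s • v) ((t - s) • -v)
    rw [hFhom _ (sub_nonneg.mpr hst)] at h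
    convert h using 2
    module
  have hle : ∀ (w : E) (s : ℝ), Ft w ≤ s ↔ F (w - s • v) ≤ s := fun w s => by
    have hw := hsol w
    refine ⟨fun h => ?_, fun h => ?_⟩
    · have := hshift w _ _ h
      nlinarith
    · by_contra! hlt
      have := hshift w _ _ hlt.le
      nlinarith
  refine ⟨?_, convex_univ, fun x _ y _ a b ha hb _ => ?_⟩
  · ext w
    simp only [Set.mem_ofPred_eq, Set.mem_image, hle, one_smul]
    exact ⟨fun h => ⟨w - v, h, sub_add_cancel w v⟩, by rintro ⟨y, hy, rfl⟩; simpa using hy⟩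
  · rw [hle, smul_eq_mul, smul_eq_mul]
    have h := hadd (a • (x - Ft x • v)) (b • (y - Ft y • v))
    rw [hFhom a ha, hFhom b hb, hsol, hsol] at h
    convert h using 2
    module
end

section
/- Let E be a finite-dimensional real normed vector space, let F be a Minkowski gauge on E that is twice continuously differentiable on E ∖ {0}, let v ∈ E satisfy F(-v) < 1, and let F̃ : E → ℝ be positively homogeneous, positive on nonzero vectors, twice continuously differentiable on E ∖ {0}, and satisfy the navigation identity F̃(y + F(y)•v) = F(y) for all y ∈ E. Let y ∈ E with F(y) = 1 and set ỹ = y + v. Then for all u, w ∈ E lying in the g^F_y-orthogonal complement of y (i.e. g^F_y(y,u) = 0 and g^F_y(y,w) = 0), one has g^{F̃}_{ỹ}(u,w) = g^F_y(u,w) / (1 + g^F_y(v,y)). -/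
/-- The fundamental tensor of a Finsler/Minkowski norm `F` at base point `y`:
`g^F_y(u,w) = (1/2) · D²(F²)(y)(u,w)`. -/
noncomputable def fundamentalTensor {E : Type*} [NormedAddCommGroup E]
    [NormedSpace ℝ E] (F : E → ℝ) (y u w : E) : ℝ :=
  (1 / 2) * ((fderiv ℝ (fun z : E => fderiv ℝ (fun x : E => F x ^ 2) z) y) u) w

open scoped Topology in
/-- A `C²` function has a first derivative near the base point, and that derivative is
differentiable there. -/
theorem ContDiffAt.eventually_hasFDerivAt_and_fderiv {E : Type*} [NormedAddCommGroup E]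
    [NormedSpace ℝ E] {F : E → ℝ} {y : E} (hF : ContDiffAt ℝ 2 F y) :
    (∀ᶠ z in 𝓝 y, HasFDerivAt F (fderiv ℝ F z) z) ∧
      HasFDerivAt (fderiv ℝ F) (fderiv ℝ (fderiv ℝ F) y) y := by
  refine ⟨?_, ?_⟩
  · filter_upwards [hF.eventually (by simp)] with z hz
    exact (hz.differentiableAt (by norm_num)).hasFDerivAt
  · exact ((hF.fderiv_right (m := 1) (by norm_num)).differentiableAt (by norm_num)).hasFDerivAt

/-- The product rule for the fundamental tensor. -/
theorem fundamentalTensor_eq {E : Type*} [NormedAddCommGroup E]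
    [NormedSpace ℝ E] {F : E → ℝ} {y : E} (hF : ContDiffAt ℝ 2 F y) (u w : E) :
    fundamentalTensor F y u w =
      F y * fderiv ℝ (fderiv ℝ F) y u w + fderiv ℝ F y u * fderiv ℝ F y w := by
  obtain ⟨h1, h2⟩ := hF.eventually_hasFDerivAt_and_fderiv
  have hsq : (fun z => fderiv ℝ (fun x => F x ^ 2) z) =ᶠ[nhds y]
      fun z => (2 * F z) • fderiv ℝ F z := by
    filter_upwards [h1] with z hz
    simpa using (hz.pow 2).fderiv
  have hd := (h1.self_of_nhds.const_mul 2).fun_smul h2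
  rw [fundamentalTensor, hsq.fderiv_eq, hd.fderiv]
  simp
  ring

/-- Euler's identity for positively homogeneous functions of degree one. -/
theorem fderiv_apply_self_of_posHomogeneous {E : Type*} [NormedAddCommGroup E]
    [NormedSpace ℝ E] {F : E → ℝ} (hhom : ∀ c : ℝ, 0 ≤ c → ∀ y : E, F (c • y) = c * F y)
    {y : E} (hF : DifferentiableAt ℝ F y) : fderiv ℝ F y y = F y := by
  have hline : HasDerivAt (fun c : ℝ => c • y) y 1 := by
    simpa using (hasDerivAt_id (1 : ℝ)).smul_const y
  have h1 : HasDerivAt (fun c : ℝ => F (c • y)) (fderiv ℝ F y y) 1 :=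
    HasFDerivAt.comp_hasDerivAt (1 : ℝ) (by simpa using hF.hasFDerivAt) hline
  have h2 : HasDerivAt (fun c : ℝ => c * F y) (F y) 1 := by
    simpa using (hasDerivAt_id (1 : ℝ)).mul_const (F y)
  refine h1.unique (h2.congr_of_eventuallyEq ?_)
  filter_upwards [lt_mem_nhds (zero_lt_one' ℝ)] with c hc
  exact hhom c hc.le y

/-- The Hessian of a positively homogeneous function of degree one annihilates the
radial direction. -/
theorem fderiv_fderiv_apply_self_of_posHomogeneous {E : Type*} [NormedAddCommGroup E]
    [NormedSpace ℝ E] {F : E → ℝ} (hhom : ∀ c : ℝ, 0 ≤ c → ∀ y : E, F (c • y) = c * F y)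
    {y : E} (hF : ContDiffAt ℝ 2 F y) (u : E) : fderiv ℝ (fderiv ℝ F) y u y = 0 := by
  obtain ⟨h1, h2⟩ := hF.eventually_hasFDerivAt_and_fderiv
  have hd := h2.clm_apply (hasFDerivAt_id y)
  have heuler : (fun z => fderiv ℝ F z (id z)) =ᶠ[nhds y] F := by
    filter_upwards [h1] with z hz
    exact fderiv_apply_self_of_posHomogeneous hhom hz.differentiableAt
  have := DFunLike.congr_fun
    (hd.unique (h1.self_of_nhds.congr_of_eventuallyEq heuler)) u
  simpa using this

/-- For a positively homogeneous function of degree one, the fundamental tensor in the radial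
direction is a multiple of the derivative. -/
theorem fundamentalTensor_apply_self {E : Type*} [NormedAddCommGroup E]
    [NormedSpace ℝ E] {F : E → ℝ} (hhom : ∀ c : ℝ, 0 ≤ c → ∀ y : E, F (c • y) = c * F y)
    {y : E} (hF : ContDiffAt ℝ 2 F y) (u : E) :
    fundamentalTensor F y u y = F y * fderiv ℝ F y u := by
  rw [fundamentalTensor_eq hF, fderiv_fderiv_apply_self_of_posHomogeneous hhom hF,
    fderiv_apply_self_of_posHomogeneous hhom (hF.differentiableAt (by norm_num))]
  ring

/-- The fundamental tensor of a `C²` function is symmetric. -/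
theorem fundamentalTensor_comm {E : Type*} [NormedAddCommGroup E]
    [NormedSpace ℝ E] {F : E → ℝ} {y : E} (hF : ContDiffAt ℝ 2 F y) (u w : E) :
    fundamentalTensor F y u w = fundamentalTensor F y w u := by
  rw [fundamentalTensor_eq hF, fundamentalTensor_eq hF,
    (hF.isSymmSndFDerivAt (by simp)).eq u w]
  ring

/-- The derivative of the navigation identity. -/
theorem fderiv_navigation {E : Type*} [NormedAddCommGroup E] [NormedSpace ℝ E]
    {F Ft : E → ℝ} {v : E} (hnav : ∀ y : E, Ft (y + F y • v) = F y) {z : E}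
    (hF : DifferentiableAt ℝ F z) (hFt : DifferentiableAt ℝ Ft (z + F z • v)) (w : E) :
    fderiv ℝ F z w = fderiv ℝ Ft (z + F z • v) w +
      fderiv ℝ F z w * fderiv ℝ Ft (z + F z • v) v := by
  have hmap : HasFDerivAt (fun x => x + F x • v)
      (ContinuousLinearMap.id ℝ E + (fderiv ℝ F z).smulRight v) z :=
    (hasFDerivAt_id z).add (hF.hasFDerivAt.smul_const v)
  have hcomp := hFt.hasFDerivAt.comp z hmap
  have heq : Ft ∘ (fun x => x + F x • v) = F := funext hnav
  rw [heq] at hcomp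
  have := DFunLike.congr_fun (hF.hasFDerivAt.unique hcomp) w
  simpa using this

/-- The second derivative of the navigation identity, in directions tangent to the level set
of `F`. -/
theorem fderiv_fderiv_navigation {E : Type*} [NormedAddCommGroup E] [NormedSpace ℝ E]
    {F Ft : E → ℝ} {v : E} (hnav : ∀ y : E, Ft (y + F y • v) = F y) {y : E}
    (hF : ContDiffAt ℝ 2 F y) (hFt : ContDiffAt ℝ 2 Ft (y + F y • v)) {u w : E}
    (hu : fderiv ℝ F y u = 0) (hw : fderiv ℝ F y w = 0) :
    fderiv ℝ (fderiv ℝ Ft) (y + F y • v) u w =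
      (1 - fderiv ℝ Ft (y + F y • v) v) * fderiv ℝ (fderiv ℝ F) y u w := by
  obtain ⟨h1, h2⟩ := hF.eventually_hasFDerivAt_and_fderiv
  obtain ⟨k1, k2⟩ := hFt.eventually_hasFDerivAt_and_fderiv
  have hmap : HasFDerivAt (fun x => x + F x • v)
      (ContinuousLinearMap.id ℝ E + (fderiv ℝ F y).smulRight v) y :=
    (hasFDerivAt_id y).add (h1.self_of_nhds.smul_const v)
  have hid : (fun z => fderiv ℝ F z w) =ᶠ[nhds y] fun z =>
      fderiv ℝ Ft (z + F z • v) w + fderiv ℝ F z w * fderiv ℝ Ft (z + F z • v) v := by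
    filter_upwards [h1, hmap.continuousAt.eventually k1] with z hz kz
    exact fderiv_navigation hnav hz.differentiableAt kz.differentiableAt w
  have hFw := h2.clm_apply (hasFDerivAt_const w y)
  have hcomp := HasFDerivAt.comp y k2 hmap
  have hFtw := hcomp.clm_apply (hasFDerivAt_const w y)
  have hFtv := hcomp.clm_apply (hasFDerivAt_const v y)
  have := DFunLike.congr_fun
    (hFw.unique ((hFtw.add (hFw.mul hFtv)).congr_of_eventuallyEq hid)) u
  simp [hu, hw] at this
  linear_combination -this

/-- Relation between the fundamental tensors of `F` and the
navigation metric `F̃` on vectors `g^F_y`-orthogonal to `y`: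
`g^{F̃}_{ỹ}(u,w) = g^F_y(u,w) / (1 + g^F_y(v,y))` for `ỹ = y + v`. -/
theorem zermelo_navigation_fundamental_tensor
    {E : Type*} [NormedAddCommGroup E] [NormedSpace ℝ E] [FiniteDimensional ℝ E]
    (F : E → ℝ)
    (hFcont : Continuous F)
    (hFconv : ConvexOn ℝ Set.univ F)
    (hFhom : ∀ c : ℝ, 0 ≤ c → ∀ y : E, F (c • y) = c * F y)
    (hFpos : ∀ y : E, y ≠ 0 → 0 < F y)
    (hFsmooth : ContDiffOn ℝ 2 F {(0 : E)}ᶜ)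
    (v : E) (hv : F (-v) < 1)
    (Ft : E → ℝ)
    (hFthom : ∀ c : ℝ, 0 ≤ c → ∀ w : E, Ft (c • w) = c * Ft w)
    (hFtpos : ∀ w : E, w ≠ 0 → 0 < Ft w)
    (hFtsmooth : ContDiffOn ℝ 2 Ft {(0 : E)}ᶜ)
    (hnav : ∀ y : E, Ft (y + F y • v) = F y)
    (y : E) (hy : F y = 1)
    (u w : E)
    (hu : fundamentalTensor F y y u = 0)
    (hw : fundamentalTensor F y y w = 0) :
    fundamentalTensor Ft (y + v) u w =
      fundamentalTensor F y u w / (1 + fundamentalTensor F y v y) := by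
  have hy0 : y ≠ 0 := by
    rintro rfl
    have := hFhom 0 le_rfl 0
    simp [hy] at this
  have hyv : y + v ≠ 0 := by
    intro h
    rw [← eq_neg_of_add_eq_zero_left h, hy] at hv
    exact lt_irrefl _ hv
  have hF : ContDiffAt ℝ 2 F y := hFsmooth.contDiffAt (isOpen_ne.mem_nhds hy0)
  have hFt : ContDiffAt ℝ 2 Ft (y + v) := hFtsmooth.contDiffAt (isOpen_ne.mem_nhds hyv)
  have hyF : y + F y • v = y + v := by rw [hy, one_smul]
  have hFty : Ft (y + v) = 1 := by rw [← hyF, hnav, hy]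
  rw [fundamentalTensor_comm hF, fundamentalTensor_apply_self hFhom hF, hy, one_mul] at hu hw
  have hfirst := fderiv_navigation hnav (hF.differentiableAt (by norm_num))
    (by rw [hyF]; exact hFt.differentiableAt (by norm_num))
  have hsecond := fderiv_fderiv_navigation hnav hF (by rwa [hyF]) hu hw
  rw [hyF] at hfirst hsecond
  have htu : fderiv ℝ Ft (y + v) u = 0 := by simpa [hu] using (hfirst u).symm
  have hmul : (1 - fderiv ℝ Ft (y + v) v) * (1 + fderiv ℝ F y v) = 1 := by
    linear_combination hfirst v
  rw [fundamentalTensor_apply_self hFhom hF, fundamentalTensor_eq hF, fundamentalTensor_eq hFt,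
    hFty, hy, hu, htu, hsecond, one_mul, one_mul, one_mul, zero_mul, zero_mul, add_zero, add_zero,
    eq_div_iff (right_ne_zero_of_mul_eq_one hmul)]
  linear_combination fderiv ℝ (fderiv ℝ F) y u w * hmul
end

section
/- Let E be a finite-dimensional real normed vector space, let F be a Minkowski gauge on E differentiable on E ∖ {0}, let v ∈ E satisfy F(-v) < 1, and let F̃ : E → ℝ be positively homogeneous, positive on nonzero vectors, differentiable on E ∖ {0}, and satisfy the navigation identity F̃(y + F(y)•v) = F(y) for all y ∈ E. Let y ∈ E with F(y) = 1 and set ỹ = y + v. Then for every u ∈ E one has DF(y)(u) = 0 if and only if DF̃(ỹ)(u) = 0; that is, the tangent hyperplane to the indicatrix {F = 1} at y coincides with the tangent hyperplane to the indicatrix {F̃ = 1} at ỹ. -/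
/-- The tangent hyperplane to the indicatrix of `F` at `y`
coincides with the tangent hyperplane to the indicatrix of the navigation
metric `F̃` at `ỹ = y + v`: `DF(y)(u) = 0 ↔ DF̃(ỹ)(u) = 0`. -/
theorem zermelo_navigation_indicatrix_tangent
    {E : Type*} [NormedAddCommGroup E] [NormedSpace ℝ E] [FiniteDimensional ℝ E]
    (F : E → ℝ)
    (hFcont : Continuous F)
    (hFconv : ConvexOn ℝ Set.univ F)
    (hFhom : ∀ c : ℝ, 0 ≤ c → ∀ y : E, F (c • y) = c * F y)
    (hFpos : ∀ y : E, y ≠ 0 → 0 < F y)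
    (hFdiff : DifferentiableOn ℝ F {(0 : E)}ᶜ)
    (v : E) (hv : F (-v) < 1)
    (Ft : E → ℝ)
    (hFthom : ∀ c : ℝ, 0 ≤ c → ∀ w : E, Ft (c • w) = c * Ft w)
    (hFtpos : ∀ w : E, w ≠ 0 → 0 < Ft w)
    (hFtdiff : DifferentiableOn ℝ Ft {(0 : E)}ᶜ)
    (hnav : ∀ y : E, Ft (y + F y • v) = F y)
    (y : E) (hy : F y = 1) :
    ∀ u : E, fderiv ℝ F y u = 0 ↔ fderiv ℝ Ft (y + v) u = 0 := by
  have hF0 : F 0 = 0 := by simpa using hFhom 0 le_rfl 0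
  have hy0 : y ≠ 0 := by
    rintro rfl
    linarith
  have hyv : y + v ≠ 0 := by
    intro h
    rw [← eq_neg_of_add_eq_zero_left h] at hv
    linarith
  have hF := (hFdiff.differentiableAt (isOpen_compl_singleton.mem_nhds hy0)).hasFDerivAt
  have hFt := (hFtdiff.differentiableAt (isOpen_compl_singleton.mem_nhds hyv)).hasFDerivAt
  have hmap := (hasFDerivAt_id (𝕜 := ℝ) y).add (hF.smul_const v)
  have hbase : y + v = id y + F y • v := by simp [hy]
  rw [hbase] at hFt
  have hcomp := hFt.comp y hmap
  have hderiv := hcomp.unique (hF.congr_of_eventuallyEq (Filter.Eventually.of_forall hnav))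
  rw [← hbase] at hderiv
  have key (w : E) :
      fderiv ℝ Ft (y + v) w = fderiv ℝ F y w * (1 - fderiv ℝ Ft (y + v) v) := by
    have h := DFunLike.congr_fun hderiv w
    simp at h
    linarith
  have hne : 1 - fderiv ℝ Ft (y + v) v ≠ 0 := by
    intro h
    have hv' := key v
    rw [h, mul_zero] at hv'
    linarith
  intro u
  simp [key u, hne]
end

section
/- Let c be a nonzero real number and let f : ℝ → ℝ be twice continuously differentiable on a neighborhood of 0. Define g : ℝ → ℝ by g(t) = e^{-c·t}·f((e^{2c·t} - 1)/(2c)). Then g is twice differentiable at 0 and g''(0) = c²·f(0) + f''(0). (This is the key reparametrization computation relating the norms of corresponding Jacobi fields before and after a homothetic navigation, from which the flag curvature shift K̃ = K - c² follows.) -/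
/-- The reparametrization `t ↦ (e^{2ct} - 1) / (2c)` has derivative `e^{2ct}`. -/
theorem hasDerivAt_exp_sub_one_div {c : ℝ} (hc : c ≠ 0) (t : ℝ) :
    HasDerivAt (fun t : ℝ => (Real.exp (2 * c * t) - 1) / (2 * c)) (Real.exp (2 * c * t)) t := by
  refine ((((hasDerivAt_id' t).const_mul (2 * c)).exp.sub_const 1).div_const (2 * c)).congr_deriv ?_
  field_simp

theorem hasDerivAt_exp_const_mul (a t : ℝ) :
    HasDerivAt (fun t : ℝ => Real.exp (a * t)) (a * Real.exp (a * t)) t := by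
  refine ((hasDerivAt_id' t).const_mul a).exp.congr_deriv ?_
  ring

/-- First derivative of the reparametrized and rescaled function. -/
theorem hasDerivAt_exp_mul_comp {c : ℝ} (hc : c ≠ 0) {f : ℝ → ℝ} {t : ℝ}
    (hf : DifferentiableAt ℝ f ((Real.exp (2 * c * t) - 1) / (2 * c))) :
    HasDerivAt (fun t => Real.exp (-c * t) * f ((Real.exp (2 * c * t) - 1) / (2 * c)))
      (-c * (Real.exp (-c * t) * f ((Real.exp (2 * c * t) - 1) / (2 * c))) +
        Real.exp (c * t) * deriv f ((Real.exp (2 * c * t) - 1) / (2 * c))) t := by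
  refine ((hasDerivAt_exp_const_mul (-c) t).mul
    (hf.hasDerivAt.comp t (hasDerivAt_exp_sub_one_div hc t))).congr_deriv ?_
  have h : Real.exp (c * t) = Real.exp (-c * t) * Real.exp (2 * c * t) := by
    rw [← Real.exp_add]
    ring_nf
  rw [h, Function.comp_apply]
  ring

/-- key reparametrization computation for homothetic navigation.
For `c ≠ 0` and `f` twice continuously differentiable near `0`, the function
`g t = e^{-c t} · f ((e^{2 c t} - 1) / (2 c))` is twice differentiable at `0`
and `g''(0) = c² · f 0 + f''(0)`. -/
theorem homothetic_navigation_key_computation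
    (c : ℝ) (hc : c ≠ 0) (f : ℝ → ℝ) (hf : ContDiffAt ℝ 2 f 0)
    (g : ℝ → ℝ)
    (hg : ∀ t : ℝ,
      g t = Real.exp (-c * t) * f ((Real.exp (2 * c * t) - 1) / (2 * c))) :
    DifferentiableAt ℝ g 0 ∧ DifferentiableAt ℝ (deriv g) 0 ∧
      deriv (deriv g) 0 = c ^ 2 * f 0 + deriv (deriv f) 0 := by
  obtain rfl := funext hg
  have hs0 : (Real.exp (2 * c * 0) - 1) / (2 * c) = 0 := by simp
  have hs := hasDerivAt_exp_sub_one_div hc 0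
  have hev : ∀ᶠ x in nhds (0 : ℝ), DifferentiableAt ℝ f x :=
    (hf.eventually (by simp)).mono fun x hx => hx.differentiableAt (by simp)
  have hf' : DifferentiableAt ℝ (deriv f) 0 :=
    (hf.derivWithin (m := 1) (by norm_num)).differentiableAt (by simp)
  have htends := hs.continuousAt.tendsto
  rw [hs0] at htends
  have hderiv := (htends.eventually hev).mono fun t ht => (hasDerivAt_exp_mul_comp hc ht).deriv
  have hg0 := hasDerivAt_exp_mul_comp hc (t := 0) (by rw [hs0]; exact hev.self_of_nhds)
  have hf'0 : HasDerivAt (deriv f) (deriv (deriv f) 0)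
      ((Real.exp (2 * c * 0) - 1) / (2 * c)) := by
    rw [hs0]
    exact hf'.hasDerivAt
  have hg' := HasDerivAt.congr_of_eventuallyEq ((hg0.const_mul (-c)).add
    ((hasDerivAt_exp_const_mul c 0).mul (hf'0.comp 0 hs)))
    (Filter.EventuallyEq.trans hderiv (Filter.EventuallyEq.of_eq rfl))
  refine ⟨hg0.differentiableAt, hg'.differentiableAt, hg'.deriv.trans ?_⟩
  simp
  ring
end
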